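/- arXiv:2402.07048 — 2 statements merged into one kernel-verified Lean document; each statement's English description precedes it below -/
import Mathlib

section
/- Let a, b > 0. For every η ∈ ℝ, the logistic-beta density satisfies the normal variance-mean mixture identity: σ(η)^a (1−σ(η))^b / B(a,b) = ∫_0^∞ (2πλ)^{−1/2} exp( −(η − λ(a−b)/2)² / (2λ) ) · π_PO(λ; a, b) dλ. -/
open Real MeasureTheory

/-- The logistic function `σ(x) = 1/(1+e^{-x})`. -/
noncomputable def logisticFn (x : ℝ) : ℝ := 1 / (1 + Real.exp (-x))

/-- The beta function `B(a,b) = Γ(a)Γ(b)/Γ(a+b)`. -/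
noncomputable def betaFn (a b : ℝ) : ℝ := Real.Gamma a * Real.Gamma b / Real.Gamma (a + b)

/-- The Pólya density with shape parameters `a, b`, as a pointwise series in `λ`. -/
noncomputable def polyaDensity (a b l : ℝ) : ℝ :=
  ∑' k : ℕ, (-1 : ℝ) ^ k * (Real.Gamma (a + b + k) / (Real.Gamma (a + b) * k.factorial)) *
    ((k : ℝ) + (a + b) / 2) * (1 / betaFn a b) * Real.exp (-((k : ℝ) + a) * ((k : ℝ) + b) * l / 2)

open Filter Topology


noncomputable def pA (P : ℝ) (k : ℕ) : ℝ := Real.Gamma (P + k) / (Real.Gamma P * k.factorial)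

lemma pA_pos {P : ℝ} (hP : 0 < P) (k : ℕ) : 0 < pA P k := by
  unfold pA
  have h1 := Real.Gamma_pos_of_pos hP
  have h2 : 0 < Real.Gamma (P + k) := Real.Gamma_pos_of_pos (by positivity)
  positivity

lemma pA_choose {P : ℝ} (hP : 0 < P) (k : ℕ) : Ring.choose (P + k - 1) k = pA P k := by
  have h0 : Ring.choose (P + k - 1) k = Ring.multichoose P k := by
    rw [Ring.choose]; congr 1; ring
  have h1 := Ring.factorial_nsmul_multichoose_eq_ascPochhammer P k
  have hG := (Real.Gamma_pos_of_pos hP).ne'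
  have h2 : (ascPochhammer ℕ k).smeval P = Real.Gamma (P + k) / Real.Gamma P := by
    rw [Polynomial.ascPochhammer_smeval_eq_eval]
    induction k with
    | zero => simp [hG]
    | succ n ih =>
      rw [ascPochhammer_succ_eval, ih (by rw [Ring.choose]; congr 1; ring)
        (Ring.factorial_nsmul_multichoose_eq_ascPochhammer P n)]
      have : Real.Gamma (P + (n + 1 : ℕ)) = (P + n) * Real.Gamma (P + n) := by
        rw [← Real.Gamma_add_one (by positivity)]; push_cast; ring_nf
      rw [this]; ring
  rw [h0, pA]
  rw [h2, nsmul_eq_mul] at h1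
  have : (k.factorial : ℝ) ≠ 0 := by positivity
  field_simp
  field_simp at h1
  linarith

lemma pA_hasSum {P : ℝ} (hP : 0 < P) {q : ℂ} (hq : ‖q‖ < 1) :
    HasSum (fun k : ℕ => (-1 : ℂ) ^ k * (pA P k : ℂ) * q ^ k) (1 / (1 + q) ^ (P : ℂ)) := by
  have h := (Complex.one_div_one_sub_cpow_hasFPowerSeriesOnBall_zero (P : ℂ)).hasSum
    (y := -q) (by simpa [enorm_eq_nnnorm, ← NNReal.coe_lt_one] using hq)
  simp only [zero_add, sub_neg_eq_add] at h
  convert! h using 2 with k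
  rw [FormalMultilinearSeries.ofScalars_apply_eq, ← pA_choose hP, Complex.ofReal_choose]
  push_cast
  rw [neg_pow q, smul_eq_mul]; ring

lemma pA_summable {P : ℝ} (hP : 0 < P) {r : ℝ} (h0 : 0 ≤ r) (hr : r < 1) :
    Summable (fun k : ℕ => pA P k * r ^ k) := by
  have h := (pA_hasSum hP (q := ((-r : ℝ) : ℂ)) (by simpa [abs_of_nonneg h0] using hr)).summable
  rw [← Complex.summable_ofReal]
  convert h using 2 with k
  push_cast
  rw [neg_pow (r : ℂ)]
  have : (-1 : ℂ) ^ k * (-1) ^ k = 1 := by rw [← mul_pow]; simp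
  linear_combination (-(pA P k : ℂ) * r ^ k) * this

lemma pA_succ {P : ℝ} (hP : 0 < P) (k : ℕ) :
    pA P k * (k + P / 2) = P * pA (P + 1) k - P / 2 * pA P k := by
  unfold pA
  have h1 : Real.Gamma (P + 1 + k) = (P + k) * Real.Gamma (P + k) := by
    rw [← Real.Gamma_add_one (by positivity)]; ring_nf
  rw [h1, Real.Gamma_add_one hP.ne']
  have hG := (Real.Gamma_pos_of_pos hP).ne'
  have : (k.factorial : ℝ) ≠ 0 := by positivity
  field_simp
  ring

lemma pA_hasSum_real {P : ℝ} (hP : 0 < P) {r : ℝ} (h0 : 0 ≤ r) (hr : r < 1) :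
    HasSum (fun k : ℕ => (-1 : ℝ) ^ k * pA P k * r ^ k) ((1 + r) ^ (-P)) := by
  have h := (pA_hasSum hP (q := (r : ℂ)) (by simpa [abs_of_nonneg h0] using hr))
  rw [← Complex.hasSum_ofReal]
  convert h using 2 with k
  · push_cast; ring
  · rw [Complex.ofReal_cpow (by positivity)]; push_cast; rw [Complex.cpow_neg, one_div]


noncomputable def pG (P c l : ℝ) : ℝ :=
  ∑' k : ℕ, (-1 : ℝ) ^ k * pA P k * rexp (-((k : ℝ) + c) ^ 2 * l / 2)

noncomputable def pF (P c l s : ℝ) (k : ℕ) (z : ℝ) : ℂ :=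
  ((-1 : ℂ) ^ k * (pA P k : ℂ)) * Complex.exp (((-(1 / (2 * l)) : ℝ) : ℂ) * (z : ℂ) ^ 2 +
    (((k + c - s / l : ℝ) : ℂ) * Complex.I) * (z : ℂ) + ((s ^ 2 / (2 * l) - (k + c) * s : ℝ) : ℂ))

lemma pF_norm {P : ℝ} (hP : 0 < P) (c l s : ℝ) (k : ℕ) (z : ℝ) :
    ‖pF P c l s k z‖ = (pA P k * rexp (-s) ^ k) * (rexp (s ^ 2 / (2 * l) - c * s) * rexp (-(1 / (2 * l)) * z ^ 2)) := by
  unfold pF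
  rw [norm_mul, Complex.norm_exp]
  have e : ((((-(1 / (2 * l)) : ℝ) : ℂ) * (z : ℂ) ^ 2 +
    (((k + c - s / l : ℝ) : ℂ) * Complex.I) * (z : ℂ) + ((s ^ 2 / (2 * l) - (k + c) * s : ℝ) : ℂ))).re
     = -(1 / (2 * l)) * z ^ 2 + (s ^ 2 / (2 * l) - (k + c) * s) := by
    rw [← Complex.ofReal_pow, ← Complex.ofReal_mul]
    simp only [Complex.add_re, Complex.ofReal_re, Complex.mul_re, Complex.I_re, Complex.I_im,
      Complex.ofReal_im, Complex.mul_im]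
    ring
  rw [e, norm_mul, norm_pow, norm_neg, norm_one, one_pow, one_mul, Complex.norm_real,
    Real.norm_of_nonneg (pA_pos hP k).le, ← Real.exp_nat_mul, mul_assoc, ← Real.exp_add, ← Real.exp_add]
  congr 2
  ring

lemma pF_integral {P c l s : ℝ} (hl : 0 < l) (k : ℕ) :
    ∫ z, pF P c l s k z = ((√(2 * π * l) * ((-1 : ℝ) ^ k * pA P k * rexp (-((k : ℝ) + c) ^ 2 * l / 2)) : ℝ) : ℂ) := by
  unfold pF
  rw [integral_const_mul, integral_cexp_quadratic (by simpa using hl)]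
  have hl' : (l : ℂ) ≠ 0 := by exact_mod_cast hl.ne'
  have e1 : ((π : ℂ) / -((-(1 / (2 * l)) : ℝ) : ℂ)) ^ (1 / 2 : ℂ) = ((√(2 * π * l) : ℝ) : ℂ) := by
    rw [Real.sqrt_eq_rpow, Complex.ofReal_cpow (by positivity)]
    congr 1
    · push_cast; field_simp
    · push_cast; rfl
  rw [e1]
  have e2 : ((s ^ 2 / (2 * l) - (k + c) * s : ℝ) : ℂ) - (((k + c - s / l : ℝ) : ℂ) * Complex.I) ^ 2 /
      (4 * ((-(1 / (2 * l)) : ℝ) : ℂ)) = ((-((k : ℝ) + c) ^ 2 * l / 2 : ℝ) : ℂ) := by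
    rw [mul_pow, Complex.I_sq]
    push_cast
    field_simp
    ring
  rw [e2]
  push_cast
  ring

lemma pF_integrable {P c l s : ℝ} (hP : 0 < P) (hl : 0 < l) (k : ℕ) : Integrable (pF P c l s k) := by
  have hc : Continuous (pF P c l s k) := by unfold pF; fun_prop
  rw [← integrable_norm_iff hc.aestronglyMeasurable]
  simp_rw [pF_norm hP]
  exact ((integrable_exp_neg_mul_sq (b := 1 / (2 * l)) (by positivity)).const_mul _).const_mul _

lemma pF_hasSum {P c l s : ℝ} (hP : 0 < P) (_hl : 0 < l) (hs : 0 < s) (z : ℝ) :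
    HasSum (fun k => pF P c l s k z) (Complex.exp (((-(1 / (2 * l)) : ℝ) : ℂ) * (z : ℂ) ^ 2 +
    (((c - s / l : ℝ) : ℂ) * Complex.I) * (z : ℂ) + ((s ^ 2 / (2 * l) - c * s : ℝ) : ℂ)) *
      (1 / (1 + Complex.exp (((-s : ℝ) : ℂ) + (z : ℂ) * Complex.I)) ^ (P : ℂ))) := by
  have hq : ‖Complex.exp (((-s : ℝ) : ℂ) + (z : ℂ) * Complex.I)‖ < 1 := by
    rw [Complex.norm_exp]; simpa using hs
  have := (pA_hasSum hP hq).mul_left (Complex.exp (((-(1 / (2 * l)) : ℝ) : ℂ) * (z : ℂ) ^ 2 +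
    (((c - s / l : ℝ) : ℂ) * Complex.I) * (z : ℂ) + ((s ^ 2 / (2 * l) - c * s : ℝ) : ℂ)))
  convert! this using 2 with k
  unfold pF
  rw [← Complex.exp_nat_mul, mul_left_comm, ← Complex.exp_add]
  congr 2
  push_cast
  ring

lemma pq_bound {P l z : ℝ} (hP : 0 < P) (hl : 0 < l) (hl1 : l ≤ 1) :
    ‖1 / (1 + Complex.exp (((-√l : ℝ) : ℂ) + (z : ℂ) * Complex.I)) ^ (P : ℂ)‖ ≤
      1 + (2 / √l) ^ P * rexp ((z ^ 2 - 1) / (4 * l)) := by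
  set q := Complex.exp (((-√l : ℝ) : ℂ) + (z : ℂ) * Complex.I) with hq
  have hs : 0 < √l := Real.sqrt_pos.2 hl
  have hs1 : √l ≤ 1 := by simpa using Real.sqrt_le_sqrt hl1
  rw [norm_div, norm_one, Complex.norm_cpow_real]
  by_cases hz : |z| ≤ 1
  · have h1 : 1 ≤ ‖1 + q‖ := by
      refine le_trans ?_ (Complex.re_le_norm _)
      have hcos : 0 ≤ Real.cos z := Real.cos_nonneg_of_mem_Icc
        ⟨by linarith [(abs_le.1 hz).1, Real.pi_gt_three], by linarith [(abs_le.1 hz).2, Real.pi_gt_three]⟩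
      have : q.re = rexp (-√l) * Real.cos z := by
        rw [hq, Complex.exp_re]; simp
      rw [Complex.add_re, this, Complex.one_re]
      have := Real.exp_pos (-√l)
      nlinarith [mul_nonneg this.le hcos]
    have h2 : 1 ≤ ‖1 + q‖ ^ P := Real.one_le_rpow h1 hP.le
    have h3 : 1 / ‖1 + q‖ ^ P ≤ 1 := by rw [div_le_one (by linarith)]; exact h2
    have : 0 ≤ (2 / √l) ^ P * rexp ((z ^ 2 - 1) / (4 * l)) := by positivity
    linarith
  · push Not at hz
    have h1 : √l / 2 ≤ ‖1 + q‖ := by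
      have hn : ‖q‖ = rexp (-√l) := by rw [hq, Complex.norm_exp]; simp
      have h2 : 1 - ‖q‖ ≤ ‖1 + q‖ := by
        have := norm_sub_norm_le (1 : ℂ) (-q)
        simpa using this
      have h3 : rexp (-√l) ≤ 1 / (1 + √l) := by
        rw [Real.exp_neg, ← one_div]
        exact one_div_le_one_div_of_le (by positivity) (by linarith [Real.add_one_le_exp (√l)])
      have h4 : 1 / (1 + √l) ≤ 1 - √l / 2 := by
        rw [div_le_iff₀ (by positivity)]; nlinarith
      rw [hn] at h2; linarith
    have h2 : 1 / ‖1 + q‖ ^ P ≤ (2 / √l) ^ P := by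
      rw [show (2 / √l) = (√l / 2)⁻¹ by rw [inv_div], Real.inv_rpow (by positivity), ← one_div]
      exact one_div_le_one_div_of_le (by positivity) (Real.rpow_le_rpow (by positivity) h1 hP.le)
    have h3 : 1 ≤ rexp ((z ^ 2 - 1) / (4 * l)) := by
      apply Real.one_le_exp
      have : 1 ≤ z ^ 2 := by rw [← sq_abs]; nlinarith
      apply div_nonneg <;> linarith
    have h4 : 0 ≤ (2 / √l) ^ P := by positivity
    nlinarith

lemma pG_bound {P c : ℝ} (hP : 0 < P) (hc : 0 < c) :
    ∃ C : ℝ, 0 ≤ C ∧ ∀ l : ℝ, 0 < l → l ≤ 1 → |pG P c l| ≤ C := by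
  refine ⟨rexp (1/2) * (1 + √2 * (8 * P) ^ (P / 2)), by positivity, fun l hl hl1 => ?_⟩
  have hs : 0 < √l := Real.sqrt_pos.2 hl
  have hsum : Summable fun k => ∫ z, ‖pF P c l (√l) k z‖ := by
    simp_rw [pF_norm hP, integral_const_mul]
    exact (pA_summable hP (Real.exp_pos _).le (by simpa using hs)).mul_right _
  have h1 := hasSum_integral_of_summable_integral_norm (fun k => pF_integrable (s := √l) (c := c) hP hl k) hsum
  simp_rw [pF_integral hl] at h1
  have h2 : ((√(2 * π * l) * pG P c l : ℝ) : ℂ) = ∫ a, ∑' i, pF P c l (√l) i a := by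
    rw [← h1.tsum_eq, ← Complex.ofReal_tsum, pG, tsum_mul_left]
  have hi1 := (integrable_exp_neg_mul_sq (b := 1 / (2 * l)) (by positivity))
  have hi2 := (integrable_exp_neg_mul_sq (b := 1 / (4 * l)) (by positivity))
  set D := (2 / √l) ^ P * rexp (-(1 / (4 * l))) with hD
  have h3 : ‖∫ a, ∑' i, pF P c l (√l) i a‖ ≤
      ∫ z : ℝ, rexp (1/2) * (rexp (-(1 / (2 * l)) * z ^ 2) + D * rexp (-(1 / (4 * l)) * z ^ 2)) := by
    refine norm_integral_le_of_norm_le ((hi1.add (hi2.const_mul D)).const_mul _) (ae_of_all _ fun z => ?_)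
    rw [(pF_hasSum hP hl hs z).tsum_eq, norm_mul]
    have e : ‖Complex.exp (((-(1 / (2 * l)) : ℝ) : ℂ) * (z : ℂ) ^ 2 +
        (((c - √l / l : ℝ) : ℂ) * Complex.I) * (z : ℂ) + ((√l ^ 2 / (2 * l) - c * √l : ℝ) : ℂ))‖
        ≤ rexp (1/2) * rexp (-(1 / (2 * l)) * z ^ 2) := by
      rw [Complex.norm_exp, ← Real.exp_add]
      apply Real.exp_le_exp.2
      rw [← Complex.ofReal_pow, ← Complex.ofReal_mul, Real.sq_sqrt hl.le]
      simp only [Complex.add_re, Complex.ofReal_re, Complex.mul_re, Complex.I_re, Complex.I_im,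
        Complex.ofReal_im, Complex.mul_im]
      have : l / (2 * l) = 1 / 2 := by field_simp
      rw [this]
      have := mul_pos hc hs
      linarith
    refine (mul_le_mul e (pq_bound hP hl hl1) (norm_nonneg _) (by positivity)).trans (le_of_eq ?_)
    have e2 : rexp (-(1 / (2 * l)) * z ^ 2) * rexp ((z ^ 2 - 1) / (4 * l)) =
        rexp (-(1 / (4 * l))) * rexp (-(1 / (4 * l)) * z ^ 2) := by
      rw [← Real.exp_add, ← Real.exp_add]; congr 1; field_simp; ring
    rw [hD]
    linear_combination rexp (1/2) * (2 / √l) ^ P * e2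
  rw [integral_const_mul, integral_add hi1 (hi2.const_mul D), integral_const_mul, integral_gaussian,
    integral_gaussian, ← h2, Complex.norm_real, norm_mul, Real.norm_eq_abs, Real.norm_eq_abs,
    abs_of_nonneg (Real.sqrt_nonneg _)] at h3
  have e4 : π / (1 / (2 * l)) = 2 * π * l := by field_simp
  have e5 : π / (1 / (4 * l)) = 2 * (2 * π * l) := by field_simp; ring
  rw [e4, e5, Real.sqrt_mul (x := 2) (by norm_num) (2 * π * l)] at h3
  have hS : 0 < √(2 * π * l) := Real.sqrt_pos.2 (by positivity)
  have h6 : |pG P c l| ≤ rexp (1/2) * (1 + √2 * D) := by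
    rw [← mul_le_mul_iff_right₀ hS]
    refine h3.trans (le_of_eq ?_)
    ring
  refine h6.trans ?_
  gcongr
  have e7 : (2 / √l) ^ P = (4 / l) ^ (P / 2) := by
    rw [show 4 / l = (2 / √l) ^ (2:ℝ) by
      rw [Real.rpow_two, div_pow, Real.sq_sqrt hl.le]; norm_num, ← Real.rpow_mul (by positivity)]
    congr 1; ring
  have e8 : 4 / l = (8 * P) * (1 / (2 * P * l)) := by field_simp; norm_num
  have e9 : (1 / (2 * P * l)) ^ (P / 2) ≤ rexp (1 / (4 * l)) := by
    calc (1 / (2 * P * l)) ^ (P / 2) ≤ rexp (1 / (2 * P * l)) ^ (P / 2) := by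
          apply Real.rpow_le_rpow (by positivity) _ (by positivity)
          linarith [Real.add_one_le_exp (1 / (2 * P * l))]
      _ = rexp (1 / (4 * l)) := by
          rw [← Real.exp_mul]; congr 1; field_simp; norm_num
  rw [hD, e7, e8, Real.mul_rpow (by positivity) (by positivity), mul_assoc]
  have : (1 / (2 * P * l)) ^ (P / 2) * rexp (-(1 / (4 * l))) ≤ 1 := by
    rw [Real.exp_neg, ← div_eq_mul_inv, div_le_one (by positivity)]; exact e9
  exact mul_le_of_le_one_right (by positivity) this

lemma pG_term_le {c l : ℝ} (hl : 0 < l) (k : ℕ) :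
    rexp (-((k : ℝ) + c) ^ 2 * l / 2) ≤ rexp (-(c ^ 2) * l / 2) * rexp (-(c * l)) ^ k := by
  rw [← Real.exp_nat_mul, ← Real.exp_add]
  apply Real.exp_le_exp.2
  nlinarith [mul_nonneg (sq_nonneg (k : ℝ)) hl.le]

lemma pG_summable {P c l : ℝ} (hP : 0 < P) (hc : 0 < c) (hl : 0 < l) :
    Summable (fun k : ℕ => (-1 : ℝ) ^ k * pA P k * rexp (-((k : ℝ) + c) ^ 2 * l / 2)) := by
  have hs := (pA_summable hP (r := rexp (-(c * l))) (Real.exp_pos _).le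
    (by simpa using mul_pos hc hl)).mul_left (rexp (-(c ^ 2) * l / 2))
  refine Summable.of_norm_bounded hs fun k => ?_
  rw [norm_mul, norm_mul, norm_pow, norm_neg, norm_one, one_pow, one_mul,
    Real.norm_of_nonneg (pA_pos hP k).le, Real.norm_of_nonneg (Real.exp_pos _).le]
  have := mul_le_mul_of_nonneg_left (pG_term_le (c := c) hl k) (pA_pos hP k).le
  linarith

lemma pG_decay {P c : ℝ} (hP : 0 < P) (hc : 0 < c) :
    ∃ C : ℝ, 0 ≤ C ∧ ∀ l : ℝ, 0 < l → |pG P c l| ≤ C * rexp (-(c ^ 2) * l / 2) := by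
  obtain ⟨C, hC0, hC⟩ := pG_bound hP hc
  have hs := (pA_summable hP (r := rexp (-c)) (Real.exp_pos _).le (by simpa using hc))
  have hS0 : 0 ≤ ∑' k, pA P k * rexp (-c) ^ k :=
    tsum_nonneg fun k => mul_nonneg (pA_pos hP k).le (by positivity)
  refine ⟨C * rexp (c ^ 2 / 2) + ∑' k, pA P k * rexp (-c) ^ k, by positivity, fun l hl => ?_⟩
  rw [add_mul]
  rcases le_total l 1 with h | h
  · have h1 : 1 ≤ rexp (c ^ 2 / 2) * rexp (-(c ^ 2) * l / 2) := by
      rw [← Real.exp_add]; apply Real.one_le_exp; nlinarith [sq_nonneg c]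
    have h2 : 0 ≤ (∑' k, pA P k * rexp (-c) ^ k) * rexp (-(c ^ 2) * l / 2) := by positivity
    have := hC l hl h
    nlinarith
  · have h2 : 0 ≤ C * rexp (c ^ 2 / 2) * rexp (-(c ^ 2) * l / 2) := by positivity
    have h3 : |pG P c l| ≤ (∑' k, pA P k * rexp (-c) ^ k) * rexp (-(c ^ 2) * l / 2) := by
      rw [← tsum_mul_right, ← Real.norm_eq_abs, pG]
      refine tsum_of_norm_bounded (hs.mul_right _).hasSum fun k => ?_
      rw [norm_mul, norm_mul, norm_pow, norm_neg, norm_one, one_pow, one_mul,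
        Real.norm_of_nonneg (pA_pos hP k).le, Real.norm_of_nonneg (Real.exp_pos _).le, mul_assoc]
      apply mul_le_mul_of_nonneg_left _ (pA_pos hP k).le
      refine (pG_term_le (c := c) hl k).trans ?_
      rw [mul_comm]
      gcongr
      nlinarith
    linarith

noncomputable def erfI (t : ℝ) : ℝ := ∫ x in (0:ℝ)..t, Real.exp (-(1/2) * x ^ 2)

lemma erfI_deriv (t : ℝ) : HasDerivAt erfI (Real.exp (-(1/2) * t ^ 2)) t := by
  unfold erfI
  have hc : Continuous (fun x : ℝ => Real.exp (-(1/2) * x ^ 2)) := by fun_prop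
  exact intervalIntegral.integral_hasDerivAt_right (hc.intervalIntegrable _ _)
    hc.aestronglyMeasurable.stronglyMeasurableAtFilter hc.continuousAt

lemma erfI_top : Tendsto erfI atTop (𝓝 (√(2 * π) / 2)) := by
  have hi := (integrable_exp_neg_mul_sq (b := 1/2) (by norm_num)).integrableOn (s := Set.Ioi 0)
  have h := intervalIntegral_tendsto_integral_Ioi 0 hi tendsto_id
  rw [integral_gaussian_Ioi] at h
  have e : 2 * π = π / (1 / 2) := by ring
  rw [e]
  exact h

lemma erfI_neg (t : ℝ) : erfI (-t) = - erfI t := by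
  unfold erfI
  have := intervalIntegral.integral_comp_neg (a := 0) (b := t) (fun x : ℝ => Real.exp (-(1/2) * x ^ 2))
  rw [intervalIntegral.integral_symm]
  simp only [neg_zero, neg_sq] at this
  rw [this]

lemma erfI_bot : Tendsto erfI atBot (𝓝 (-(√(2 * π) / 2))) := by
  have := (erfI_top.comp tendsto_neg_atBot_atTop).neg
  refine this.congr fun x => ?_
  simp [erfI_neg]

noncomputable def igAnti (m y l : ℝ) : ℝ :=
  (1 / (m * √(2 * π))) * (rexp (-(m * y)) * erfI (m * √l - y / √l) + rexp (m * y) * erfI (m * √l + y / √l))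

lemma igAnti_deriv {m y l : ℝ} (hm : 0 < m) (hl : 0 < l) :
    HasDerivAt (igAnti m y)
      ((2 * π * l) ^ (-(1 : ℝ) / 2) * rexp (-y ^ 2 / (2 * l)) * rexp (-(m ^ 2) * l / 2)) l := by
  have hs : HasDerivAt (fun l => √l) (1 / (2 * √l)) l := Real.hasDerivAt_sqrt hl.ne'
  have hsp : 0 < √l := Real.sqrt_pos.2 hl
  have hi : HasDerivAt (fun l => y / √l) (-(y * (1 / (2 * √l))) / (√l) ^ 2) l := by
    convert! (hasDerivAt_const l y).fun_div hs hsp.ne' using 1; ring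
  have hu := (erfI_deriv (m * √l - y / √l)).comp l ((hs.const_mul m).sub hi)
  have hv := (erfI_deriv (m * √l + y / √l)).comp l ((hs.const_mul m).add hi)
  have h := ((hu.const_mul (rexp (-(m * y)))).add (hv.const_mul (rexp (m * y)))).const_mul (1 / (m * √(2 * π)))
  unfold igAnti
  refine h.congr_deriv ?_
  have e1 : rexp (-(m * y)) * rexp (-(1/2) * (m * √l - y / √l) ^ 2) =
      rexp (-y ^ 2 / (2 * l)) * rexp (-(m ^ 2) * l / 2) := by
    rw [← Real.exp_add, ← Real.exp_add]; congr 1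
    field_simp
    rw [Real.sq_sqrt hl.le]
    have : √l ^ 4 = l ^ 2 := by rw [show 4 = 2 * 2 by rfl, pow_mul, Real.sq_sqrt hl.le]
    ring_nf
    try rw [this]
    try rw [Real.sq_sqrt hl.le]
    try ring
  have e2 : rexp (m * y) * rexp (-(1/2) * (m * √l + y / √l) ^ 2) =
      rexp (-y ^ 2 / (2 * l)) * rexp (-(m ^ 2) * l / 2) := by
    rw [← Real.exp_add, ← Real.exp_add]; congr 1
    field_simp
    rw [Real.sq_sqrt hl.le]
    have : √l ^ 4 = l ^ 2 := by rw [show 4 = 2 * 2 by rfl, pow_mul, Real.sq_sqrt hl.le]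
    ring_nf
    try rw [this]
    try rw [Real.sq_sqrt hl.le]
    try ring
  have e3 : (2 * π * l) ^ (-(1 : ℝ) / 2) = 1 / (√(2 * π) * √l) := by
    rw [← Real.sqrt_mul (by positivity), Real.sqrt_eq_rpow, neg_div, Real.rpow_neg (by positivity), one_div, one_div]
  rw [e3, mul_assoc]
  rw [← mul_assoc (rexp (-(m * y))), ← mul_assoc (rexp (m * y)), e1, e2]
  generalize rexp (-y ^ 2 / (2 * l)) * rexp (-(m ^ 2) * l / 2) = K
  field_simp
  ring

lemma ig_tend_top {m : ℝ} (y : ℝ) (hm : 0 < m) : Tendsto (fun l => m * √l - y / √l) atTop atTop := by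
  have h1 : Tendsto (fun l : ℝ => m * √l) atTop atTop := Real.tendsto_sqrt_atTop.const_mul_atTop hm
  have h2 : Tendsto (fun l : ℝ => y / √l) atTop (𝓝 0) := Real.tendsto_sqrt_atTop.const_div_atTop y
  simpa [sub_eq_add_neg] using h1.atTop_add h2.neg

lemma igAnti_top {m y : ℝ} (hm : 0 < m) :
    Tendsto (igAnti m y) atTop (𝓝 ((rexp (-(m * y)) + rexp (m * y)) / (2 * m))) := by
  have h1 := erfI_top.comp (ig_tend_top y hm)
  have h2 := erfI_top.comp (ig_tend_top (-y) hm)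
  have := ((h1.const_mul (rexp (-(m * y)))).add (h2.const_mul (rexp (m * y)))).const_mul (1 / (m * √(2 * π)))
  have e : ((rexp (-(m * y)) + rexp (m * y)) / (2 * m)) = 1 / (m * √(2 * π)) *
    (rexp (-(m * y)) * (√(2 * π) / 2) + rexp (m * y) * (√(2 * π) / 2)) := by
    field_simp
  rw [e]
  refine this.congr fun l => ?_
  simp [igAnti, neg_div]

lemma igAnti_zero {m y : ℝ} (hm : 0 < m) (hy : 0 < y) :
    Tendsto (igAnti m y) (𝓝[>] 0) (𝓝 ((-rexp (-(m * y)) + rexp (m * y)) / (2 * m))) := by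
  have h0 : Tendsto (fun l : ℝ => √l) (𝓝[>] 0) (𝓝[>] 0) := by
    refine tendsto_nhdsWithin_iff.2 ⟨?_, ?_⟩
    · have : Tendsto (fun l : ℝ => √l) (𝓝 0) (𝓝 (√0)) := Real.continuous_sqrt.tendsto 0
      rw [Real.sqrt_zero] at this
      exact this.mono_left nhdsWithin_le_nhds
    · filter_upwards [self_mem_nhdsWithin] with l hl using Real.sqrt_pos.2 hl
  have hd : Tendsto (fun l : ℝ => y / √l) (𝓝[>] 0) atTop := by
    simpa [div_eq_mul_inv] using (h0.inv_tendsto_nhdsGT_zero).const_mul_atTop hy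
  have hm' : Tendsto (fun l : ℝ => m * √l) (𝓝[>] 0) (𝓝 0) := by
    simpa using (h0.mono_right nhdsWithin_le_nhds).const_mul m
  have hu : Tendsto (fun l : ℝ => m * √l - y / √l) (𝓝[>] 0) atBot := by
    simpa [sub_eq_add_neg] using hm'.add_atBot (tendsto_neg_atTop_atBot.comp hd)
  have hv : Tendsto (fun l : ℝ => m * √l + y / √l) (𝓝[>] 0) atTop := hm'.add_atTop hd
  have h1 := erfI_bot.comp hu
  have h2 := erfI_top.comp hv
  have := ((h1.const_mul (rexp (-(m * y)))).add (h2.const_mul (rexp (m * y)))).const_mul (1 / (m * √(2 * π)))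
  have e : ((-rexp (-(m * y)) + rexp (m * y)) / (2 * m)) = 1 / (m * √(2 * π)) *
    (rexp (-(m * y)) * (-(√(2 * π) / 2)) + rexp (m * y) * (√(2 * π) / 2)) := by
    field_simp
  rw [e]
  exact this

lemma ig_integral {m y : ℝ} (hm : 0 < m) (hy : 0 < y) :
    IntegrableOn (fun l => (2 * π * l) ^ (-(1 : ℝ) / 2) * rexp (-y ^ 2 / (2 * l)) * rexp (-(m ^ 2) * l / 2)) (Set.Ioi 0) ∧
    ∫ l in Set.Ioi 0, (2 * π * l) ^ (-(1 : ℝ) / 2) * rexp (-y ^ 2 / (2 * l)) * rexp (-(m ^ 2) * l / 2)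
      = rexp (-(m * y)) / m := by
  set L := ((-rexp (-(m * y)) + rexp (m * y)) / (2 * m)) with hL
  let f := Function.update (igAnti m y) 0 L
  have hc : ContinuousWithinAt f (Set.Ici 0) 0 := by
    rw [continuousWithinAt_update_same]
    rw [Set.Ici_sdiff_left]
    exact igAnti_zero hm hy
  have hev : ∀ l : ℝ, 0 < l → f =ᶠ[𝓝 l] igAnti m y := fun l hl => by
    filter_upwards [lt_mem_nhds hl] with x hx
    simp [f, Function.update_of_ne hx.ne']
  have hd : ∀ l ∈ Set.Ioi (0:ℝ), HasDerivAt f ((2 * π * l) ^ (-(1 : ℝ) / 2) * rexp (-y ^ 2 / (2 * l)) * rexp (-(m ^ 2) * l / 2)) l :=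
    fun l hl => (igAnti_deriv hm hl).congr_of_eventuallyEq (hev l hl)
  have hp : ∀ l ∈ Set.Ioi (0:ℝ), 0 ≤ ((2 * π * l) ^ (-(1 : ℝ) / 2) * rexp (-y ^ 2 / (2 * l)) * rexp (-(m ^ 2) * l / 2)) := by
    intro l hl
    have : (0:ℝ) < l := hl
    positivity
  have ht : Tendsto f atTop (𝓝 ((rexp (-(m * y)) + rexp (m * y)) / (2 * m))) := by
    refine (igAnti_top hm).congr' ?_
    filter_upwards [eventually_gt_atTop 0] with x hx
    simp [f, Function.update_of_ne hx.ne']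
  refine ⟨integrableOn_Ioi_deriv_of_nonneg hc hd hp ht, ?_⟩
  rw [integral_Ioi_of_hasDerivAt_of_nonneg hc hd hp ht]
  simp only [f, Function.update_self, hL]
  field_simp
  ring

/-- The theta-like series of the mixing density, with the completed square. -/
noncomputable def pg (p l : ℝ) : ℝ :=
  ∑' k : ℕ, (-1 : ℝ) ^ k * pA p k * ((k : ℝ) + p / 2) * rexp (-((k : ℝ) + p / 2) ^ 2 * l / 2)

lemma pg_eq {p l : ℝ} (hp : 0 < p) (hl : 0 < l) :
    pg p l = p * pG (p + 1) (p / 2) l - p / 2 * pG p (p / 2) l := by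
  have h1 := (pG_summable (P := p + 1) (c := p / 2) (by positivity) (by positivity) hl).hasSum.mul_left p
  have h2 := (pG_summable (P := p) (c := p / 2) (by positivity) (by positivity) hl).hasSum.mul_left (p / 2)
  rw [pG, pG, ← (h1.sub h2).tsum_eq, pg]
  congr 1
  ext k
  have := pA_succ hp k
  linear_combination ((-1 : ℝ) ^ k * rexp (-((k : ℝ) + p / 2) ^ 2 * l / 2)) * this

lemma pg_decay {p : ℝ} (hp : 0 < p) :
    ∃ C : ℝ, 0 ≤ C ∧ ∀ l : ℝ, 0 < l → |pg p l| ≤ C * rexp (-((p / 2) ^ 2) * l / 2) := by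
  obtain ⟨C1, h10, h1⟩ := pG_decay (P := p + 1) (c := p / 2) (by positivity) (by positivity)
  obtain ⟨C2, h20, h2⟩ := pG_decay (P := p) (c := p / 2) (by positivity) (by positivity)
  refine ⟨p * C1 + p / 2 * C2, by positivity, fun l hl => ?_⟩
  rw [pg_eq hp hl]
  refine (abs_sub _ _).trans ?_
  rw [abs_mul, abs_mul, abs_of_pos hp, abs_of_pos (half_pos hp)]
  have a1 := mul_le_mul_of_nonneg_left (h1 l hl) hp.le
  have a2 := mul_le_mul_of_nonneg_left (h2 l hl) (half_pos hp).le
  linarith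

lemma pg_measurable (p : ℝ) : Measurable (pg p) := by
  unfold pg
  exact Measurable.tsum fun k => by fun_prop

lemma J_pos {p y : ℝ} (hp : 0 < p) (hy : 0 < y) :
    ∫ l in Set.Ioi (0 : ℝ), (2 * π * l) ^ (-(1 : ℝ) / 2) * rexp (-y ^ 2 / (2 * l)) * pg p l =
      rexp (-(p / 2 * y)) * (1 + rexp (-y)) ^ (-p) := by
  have hm : ∀ k : ℕ, 0 < (k : ℝ) + p / 2 := fun k => by positivity
  let F : ℕ → ℝ → ℝ := fun k l => ((-1 : ℝ) ^ k * pA p k * ((k : ℝ) + p / 2)) *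
    ((2 * π * l) ^ (-(1 : ℝ) / 2) * rexp (-y ^ 2 / (2 * l)) * rexp (-(((k : ℝ) + p / 2) ^ 2) * l / 2))
  have hr : rexp (-y) < 1 := by simpa using hy
  have hexp : ∀ k : ℕ, rexp (-(((k : ℝ) + p / 2) * y)) = rexp (-(p / 2 * y)) * rexp (-y) ^ k := by
    intro k
    rw [← Real.exp_nat_mul, ← Real.exp_add]; congr 1; ring
  have hint : ∀ k, Integrable (F k) (volume.restrict (Set.Ioi 0)) := fun k =>
    ((ig_integral (hm k) hy).1).const_mul _
  have hval : ∀ k, ∫ l in Set.Ioi 0, F k l = rexp (-(p / 2 * y)) * ((-1) ^ k * pA p k * rexp (-y) ^ k) := by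
    intro k
    simp only [F]
    rw [integral_const_mul, (ig_integral (hm k) hy).2, hexp]
    have := (hm k).ne'
    field_simp
  have hnorm : ∀ k, ∫ l in Set.Ioi 0, ‖F k l‖ = rexp (-(p / 2 * y)) * (pA p k * rexp (-y) ^ k) := by
    intro k
    have : ∀ l ∈ Set.Ioi (0:ℝ), ‖F k l‖ = (pA p k * ((k : ℝ) + p / 2)) *
      ((2 * π * l) ^ (-(1 : ℝ) / 2) * rexp (-y ^ 2 / (2 * l)) * rexp (-(((k : ℝ) + p / 2) ^ 2) * l / 2)) := by
      intro l hl
      have hl' : (0:ℝ) < l := hl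
      simp only [F]
      rw [norm_mul, norm_mul, norm_mul, norm_pow, norm_neg, norm_one, one_pow, one_mul,
        Real.norm_of_nonneg (pA_pos hp k).le, Real.norm_of_nonneg (hm k).le]
      congr 1
      exact Real.norm_of_nonneg (by positivity)
    rw [setIntegral_congr_fun measurableSet_Ioi this, integral_const_mul, (ig_integral (hm k) hy).2, hexp]
    have := (hm k).ne'
    field_simp
  have hsum : Summable fun k => ∫ l in Set.Ioi 0, ‖F k l‖ := by
    simp_rw [hnorm]
    exact (pA_summable hp (Real.exp_pos _).le hr).mul_left _
  have h := hasSum_integral_of_summable_integral_norm hint hsum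
  simp_rw [hval] at h
  have h' := (pA_hasSum_real hp (Real.exp_pos (-y)).le hr).mul_left (rexp (-(p / 2 * y)))
  rw [← h.unique h']
  congr 1
  ext l
  rw [pg, ← tsum_mul_left]
  congr 1
  ext k
  simp only [F]
  ring

lemma J_zero {p : ℝ} (hp : 0 < p) :
    ∫ l in Set.Ioi (0 : ℝ), (2 * π * l) ^ (-(1 : ℝ) / 2) * rexp (-0 ^ 2 / (2 * l)) * pg p l =
      rexp (-(p / 2 * 0)) * (1 + rexp (-0)) ^ (-p) := by
  obtain ⟨C, hC0, hC⟩ := pg_decay hp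
  have hlim : Tendsto (fun y : ℝ => ∫ l in Set.Ioi (0 : ℝ),
      (2 * π * l) ^ (-(1 : ℝ) / 2) * rexp (-y ^ 2 / (2 * l)) * pg p l) (𝓝[>] 0)
      (𝓝 (∫ l in Set.Ioi (0 : ℝ), (2 * π * l) ^ (-(1 : ℝ) / 2) * rexp (-0 ^ 2 / (2 * l)) * pg p l)) := by
    refine tendsto_integral_filter_of_dominated_convergence
      (fun l => ((2 * π) ^ (-(1 : ℝ) / 2) * C) * (l ^ (-(1 : ℝ) / 2) * rexp (-((p / 2) ^ 2 / 2) * l ^ (1 : ℝ)))) ?_ ?_ ?_ ?_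
    · refine Eventually.of_forall fun y => Measurable.aestronglyMeasurable ?_
      have := pg_measurable p
      fun_prop
    · refine Eventually.of_forall fun y => ?_
      filter_upwards [ae_restrict_mem measurableSet_Ioi] with l hl
      have hl' : (0 : ℝ) < l := hl
      rw [norm_mul, norm_mul, Real.norm_of_nonneg (by positivity), Real.norm_of_nonneg (Real.exp_pos _).le,
        Real.norm_eq_abs, Real.mul_rpow (by positivity) hl'.le, Real.rpow_one]
      have h1 : rexp (-y ^ 2 / (2 * l)) ≤ 1 := by
        apply Real.exp_le_one_iff.2
        rw [neg_div]
        have : 0 ≤ y ^ 2 / (2 * l) := by positivity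
        linarith
      calc (2 * π) ^ (-(1 : ℝ) / 2) * l ^ (-(1 : ℝ) / 2) * rexp (-y ^ 2 / (2 * l)) * |pg p l|
          ≤ (2 * π) ^ (-(1 : ℝ) / 2) * l ^ (-(1 : ℝ) / 2) * 1 * (C * rexp (-((p / 2) ^ 2) * l / 2)) := by
            gcongr
            exact hC l hl'
        _ = _ := by
            rw [show -((p / 2) ^ 2) * l / 2 = -((p / 2) ^ 2 / 2) * l by ring]; ring
    · exact (integrableOn_rpow_mul_exp_neg_mul_rpow (by norm_num) one_pos (by positivity)).const_mul _
    · refine ae_of_all _ fun l => ?_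
      have hcont : Continuous fun y : ℝ =>
        (2 * π * l) ^ (-(1 : ℝ) / 2) * rexp (-y ^ 2 / (2 * l)) * pg p l := by fun_prop
      exact (hcont.tendsto 0).mono_left nhdsWithin_le_nhds
  have hlim2 : Tendsto (fun y : ℝ => rexp (-(p / 2 * y)) * (1 + rexp (-y)) ^ (-p)) (𝓝[>] 0)
      (𝓝 (rexp (-(p / 2 * 0)) * (1 + rexp (-0)) ^ (-p))) := by
    have hcont : Continuous fun y : ℝ => rexp (-(p / 2 * y)) * (1 + rexp (-y)) ^ (-p) := by
      refine Continuous.mul (by fun_prop) (Continuous.rpow_const (by fun_prop) fun y => Or.inl ?_)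
      positivity
    exact (hcont.tendsto 0).mono_left nhdsWithin_le_nhds
  refine tendsto_nhds_unique hlim (hlim2.congr' ?_)
  filter_upwards [self_mem_nhdsWithin] with y hy
  exact (J_pos hp hy).symm

lemma J_all {p : ℝ} (hp : 0 < p) (η : ℝ) :
    ∫ l in Set.Ioi (0 : ℝ), (2 * π * l) ^ (-(1 : ℝ) / 2) * rexp (-η ^ 2 / (2 * l)) * pg p l =
      rexp (-(p / 2 * |η|)) * (1 + rexp (-|η|)) ^ (-p) := by
  rw [← sq_abs η]
  rcases (abs_nonneg η).eq_or_lt with h | h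
  · rw [← h]; exact J_zero hp
  · exact J_pos hp h

lemma polya_eq (a b l : ℝ) :
    polyaDensity a b l = (1 / betaFn a b) * rexp (((a - b) / 2) ^ 2 * l / 2) * pg (a + b) l := by
  rw [polyaDensity, pg, ← tsum_mul_left]
  congr 1
  ext k
  have : rexp (-((k : ℝ) + a) * ((k : ℝ) + b) * l / 2) =
      rexp (((a - b) / 2) ^ 2 * l / 2) * rexp (-((k : ℝ) + (a + b) / 2) ^ 2 * l / 2) := by
    rw [← Real.exp_add]; congr 1; ring
  rw [this, pA]
  ring

lemma lhs_eq (a b η : ℝ) :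
    logisticFn η ^ a * (1 - logisticFn η) ^ b =
      rexp (η * ((a - b) / 2)) * (rexp (-((a + b) / 2 * |η|)) * (1 + rexp (-|η|)) ^ (-(a + b))) := by
  have hpos : ∀ x : ℝ, 0 < 1 + rexp x := fun x => by positivity
  have key : ∀ x u v : ℝ, (1 / (1 + rexp x)) ^ u * (rexp x / (1 + rexp x)) ^ v =
      rexp (x * v) * (1 + rexp x) ^ (-(u + v)) := by
    intro x u v
    rw [Real.div_rpow (by positivity) (by positivity), Real.div_rpow (by positivity) (by positivity),
      Real.one_rpow, ← Real.exp_mul, Real.rpow_neg (by positivity), Real.rpow_add (hpos x)]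
    field_simp
  have h1 : 1 - logisticFn η = rexp (-η) / (1 + rexp (-η)) := by
    rw [logisticFn]; have := (hpos (-η)).ne'; field_simp; ring
  rcases le_total 0 η with h | h
  · rw [abs_of_nonneg h, h1, logisticFn, key, ← mul_assoc, ← Real.exp_add]
    congr 2; ring
  · have h2 : 1 - logisticFn η = 1 / (1 + rexp η) := by
      rw [h1, Real.exp_neg]; field_simp; ring
    have h3 : logisticFn η = rexp η / (1 + rexp η) := by
      have := (hpos η).ne'
      have h4 : logisticFn η = 1 - 1 / (1 + rexp η) := by linarith
      rw [h4]; field_simp; ring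
    rw [abs_of_nonpos h, h2, h3, mul_comm, key, ← mul_assoc, ← Real.exp_add, neg_neg, add_comm b a]
    congr 2; ring

/-- The normal variance-mean mixture representation of the logistic-beta density
(equation (2) of the paper). -/
theorem logisticBeta_normal_variance_mean_mixture (a b : ℝ) (ha : 0 < a) (hb : 0 < b) :
    ∀ η : ℝ,
      logisticFn η ^ a * (1 - logisticFn η) ^ b / betaFn a b =
        ∫ l in Set.Ioi (0 : ℝ),
          (2 * Real.pi * l) ^ (-(1 : ℝ) / 2) *
            Real.exp (-(η - l * (a - b) / 2) ^ 2 / (2 * l)) * polyaDensity a b l := by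
  intro η
  have h : ∀ l ∈ Set.Ioi (0 : ℝ), (2 * Real.pi * l) ^ (-(1 : ℝ) / 2) *
            Real.exp (-(η - l * (a - b) / 2) ^ 2 / (2 * l)) * polyaDensity a b l =
      (rexp (η * ((a - b) / 2)) / betaFn a b) *
        ((2 * π * l) ^ (-(1 : ℝ) / 2) * rexp (-η ^ 2 / (2 * l)) * pg (a + b) l) := by
    intro l hl
    have hl' : l ≠ 0 := (Set.mem_Ioi.1 hl).ne'
    have e : Real.exp (-(η - l * (a - b) / 2) ^ 2 / (2 * l)) * rexp (((a - b) / 2) ^ 2 * l / 2) =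
        rexp (η * ((a - b) / 2)) * rexp (-η ^ 2 / (2 * l)) := by
      rw [← Real.exp_add, ← Real.exp_add]; congr 1; field_simp; ring
    rw [polya_eq]
    linear_combination ((2 * Real.pi * l) ^ (-(1 : ℝ) / 2) * (1 / betaFn a b) * pg (a + b) l) * e
  rw [setIntegral_congr_fun measurableSet_Ioi h, integral_const_mul, J_all (by positivity), lhs_eq]
  ring
end

section
/- Let a, b > 0. The Pólya density π_PO(λ; a, b) = Σ_{k=0}^∞ (-1)^k [Γ(a+b+k)/(Γ(a+b)·k!)] · (k + (a+b)/2) · (1/B(a,b)) · exp(−(k+a)(k+b)λ/2) integrates to one over (0, ∞): ∫_0^∞ π_PO(λ; a, b) dλ = 1. -/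
open Real MeasureTheory

open Filter Topology Finset

namespace PolyaAux

noncomputable def r (a b : ℝ) (k : ℕ) : ℝ := ((k : ℝ) + a) * ((k : ℝ) + b) / 2

noncomputable def w (a b : ℝ) (N k : ℕ) : ℝ :=
  ∏ j ∈ (range (N + 1)).erase k, r a b j / (r a b j - r a b k)

noncomputable def W (a b : ℝ) (k : ℕ) : ℝ :=
  (-1) ^ k * Real.Gamma (a + b + k) * (2 * k + a + b) /
    (k.factorial * Real.Gamma a * Real.Gamma b * ((k + a) * (k + b)))

lemma r_pos {a b : ℝ} (ha : 0 < a) (hb : 0 < b) (k : ℕ) : 0 < r a b k := by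
  unfold r; positivity

lemma r_sub (a b : ℝ) (j k : ℕ) :
    r a b j - r a b k = ((j : ℝ) - k) * ((j : ℝ) + k + a + b) / 2 := by
  unfold r; ring

lemma r_strictMono {a b : ℝ} (ha : 0 < a) (hb : 0 < b) : StrictMono (r a b) := by
  intro j k h
  have h' : (j : ℝ) < k := by exact_mod_cast h
  rw [← sub_pos, r_sub]
  have : 0 < (k : ℝ) - j := by linarith
  positivity

lemma w_succ {a b : ℝ} {N k : ℕ} (h : k ≤ N) :
    w a b (N + 1) k = w a b N k * (r a b (N + 1) / (r a b (N + 1) - r a b k)) := by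
  unfold w
  rw [range_add_one (n := N + 1), erase_insert_of_ne (by omega), prod_insert (by simp), mul_comm]

lemma sum_w {a b : ℝ} (ha : 0 < a) (hb : 0 < b) (N : ℕ) :
    ∑ k ∈ range (N + 1), w a b N k = 1 := by
  have h := Lagrange.sum_basis (s := range (N + 1)) (v := r a b)
    ((r_strictMono ha hb).injective.injOn) ⟨0, by simp⟩
  have h2 := congrArg (Polynomial.eval 0) h
  rw [Polynomial.eval_finsetSum, Polynomial.eval_one] at h2
  rw [← h2]
  refine sum_congr rfl fun k hk => ?_
  unfold w Lagrange.basis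
  rw [Polynomial.eval_prod]
  refine prod_congr rfl fun j hj => ?_
  have hne : r a b j ≠ r a b k := (r_strictMono ha hb).injective.ne (by simp at hj; exact hj.1)
  simp only [Lagrange.basisDivisor, Polynomial.eval_mul, Polynomial.eval_C, Polynomial.eval_sub, Polynomial.eval_X]
  have h1 : r a b j - r a b k ≠ 0 := sub_ne_zero.2 hne
  have h2 : r a b k - r a b j ≠ 0 := sub_ne_zero.2 hne.symm
  field_simp
  ring

noncomputable def S (a b : ℝ) (N : ℕ) (l : ℝ) : ℝ :=
  ∑ k ∈ range (N + 1), w a b N k * exp (-r a b k * l)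

noncomputable def f (a b : ℝ) (N : ℕ) (l : ℝ) : ℝ :=
  ∑ k ∈ range (N + 1), w a b N k * (r a b k * exp (-r a b k * l))

lemma f_succ {a b : ℝ} (ha : 0 < a) (hb : 0 < b) (N : ℕ) (l : ℝ) :
    f a b (N + 1) l = r a b (N + 1) * (S a b (N + 1) l - S a b N l) := by
  unfold f S
  rw [sum_range_succ _ (N + 1), sum_range_succ _ (N + 1), add_sub_right_comm, ← sum_sub_distrib,
    mul_add, mul_sum]
  congr 1
  · refine sum_congr rfl fun k hk => ?_
    have hk' : k < N + 1 := by simpa using hk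
    rw [w_succ (by omega)]
    have : r a b (N + 1) - r a b k ≠ 0 := (sub_pos.2 (r_strictMono ha hb hk')).ne'
    field_simp
    ring
  · ring

lemma S_zero {a b : ℝ} (ha : 0 < a) (hb : 0 < b) (N : ℕ) : S a b N 0 = 1 := by
  simp [S, sum_w ha hb]

lemma f_nonneg {a b : ℝ} (ha : 0 < a) (hb : 0 < b) (N : ℕ) :
    ∀ l : ℝ, 0 ≤ l → 0 ≤ f a b N l := by
  induction N with
  | zero =>
    intro l _
    have := r_pos ha hb 0
    simp [f, w]
    positivity
  | succ N ih =>
    have hd : ∀ l : ℝ, HasDerivAt (fun l => exp (r a b (N + 1) * l) * f a b (N + 1) l)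
        (exp (r a b (N + 1) * l) * (r a b (N + 1) * f a b N l)) l := by
      intro l
      have h1 : HasDerivAt (f a b (N + 1)) (∑ k ∈ range (N + 1 + 1),
          w a b (N + 1) k * (r a b k * (exp (-r a b k * l) * (-r a b k)))) l := by
        unfold f
        refine HasDerivAt.fun_sum fun k _ => ?_
        refine HasDerivAt.const_mul _ (HasDerivAt.const_mul _ (HasDerivAt.exp ?_))
        exact ((hasDerivAt_id' l).const_mul (-r a b k)).congr_deriv (mul_one _)
      have h2 : HasDerivAt (fun l => exp (r a b (N + 1) * l))
          (exp (r a b (N + 1) * l) * r a b (N + 1)) l :=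
        HasDerivAt.exp (by simpa using (hasDerivAt_id l).const_mul (r a b (N + 1)))
      refine (h2.mul h1).congr_deriv ?_
      rw [mul_assoc, ← mul_add]
      congr 1
      unfold f
      rw [mul_sum, ← sum_add_distrib, sum_range_succ, mul_sum]
      have : ∀ x y z : ℝ, z = 0 → x = y → x + z = y := by intros; linarith
      refine this _ _ _ (by ring) (sum_congr rfl fun k hk => ?_)
      have hk' : k < N + 1 := by simpa using hk
      rw [w_succ (by omega)]
      have : r a b (N + 1) - r a b k ≠ 0 := (sub_pos.2 (r_strictMono ha hb hk')).ne'
      field_simp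
      ring
    have hm : MonotoneOn (fun l => exp (r a b (N + 1) * l) * f a b (N + 1) l) (Set.Ici 0) := by
      refine monotoneOn_of_deriv_nonneg (convex_Ici 0)
        (fun x _ => (hd x).continuousAt.continuousWithinAt)
        (fun x _ => (hd x).differentiableAt.differentiableWithinAt) fun x hx => ?_
      rw [(hd x).deriv]
      have := r_pos ha hb (N + 1)
      have := ih x (by simp at hx; exact hx.le)
      positivity
    intro l hl
    have := hm (by simp) (by simpa using hl) hl
    simp only [f_succ ha hb N 0, S_zero ha hb] at this
    simp only [sub_self, mul_zero] at this
    exact nonneg_of_mul_nonneg_right this (exp_pos _)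

lemma S_mono {a b : ℝ} (ha : 0 < a) (hb : 0 < b) {l : ℝ} (hl : 0 ≤ l) :
    Monotone (fun N => S a b N l) := by
  refine monotone_nat_of_le_succ fun N => ?_
  have h := f_nonneg ha hb (N + 1) l hl
  rw [f_succ ha hb] at h
  have := nonneg_of_mul_nonneg_right h (r_pos ha hb (N + 1))
  linarith

lemma prod_erase_sub (k m : ℕ) :
    ∏ j ∈ (range (k + m + 1)).erase k, ((j : ℝ) - k) = (-1) ^ k * k.factorial * m.factorial := by
  induction m with
  | zero =>
    have : (range (k + 0 + 1)).erase k = range k := by ext; simp; omega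
    rw [this, ← prod_range_reflect]
    have : ∀ j ∈ range k, (((k - 1 - j : ℕ) : ℝ) - k) = (-1) * ((j + 1 : ℕ) : ℝ) := by
      intro j hj
      have : j < k := by simpa using hj
      rw [Nat.sub_sub, Nat.cast_sub (by omega)]; push_cast; ring
    rw [prod_congr rfl this, prod_mul_distrib, ← Nat.cast_prod, prod_range_add_one_eq_factorial]
    simp
  | succ m ih =>
    rw [← add_assoc, range_add_one (n := k + m + 1), erase_insert_of_ne (by omega),
      prod_insert (by simp), ih, Nat.factorial_succ]
    push_cast; ring

lemma w_closed {a b : ℝ} (ha : 0 < a) (hb : 0 < b) (k m : ℕ) (hm : 0 < m) :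
    w a b (k + m) k = (-1) ^ k * (2 * k + a + b) / (k.factorial * ((k + a) * (k + b))) *
      (Real.GammaSeq (a + b + k) (k + m) / (Real.GammaSeq a (k + m) * Real.GammaSeq b (k + m))) *
      (((k + m).descFactorial k : ℝ) / ((k + m : ℕ) : ℝ) ^ k) := by
  have e1 : w a b (k + m) k = (∏ j ∈ (range (k + m + 1)).erase k, (a + (j : ℝ))) *
      (∏ j ∈ (range (k + m + 1)).erase k, (b + (j : ℝ))) /
      ((∏ j ∈ (range (k + m + 1)).erase k, ((j : ℝ) - k)) *
       (∏ j ∈ (range (k + m + 1)).erase k, (a + b + k + (j : ℝ)))) := by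
    unfold w
    rw [← prod_mul_distrib, ← prod_mul_distrib, ← prod_div_distrib]
    refine prod_congr rfl fun j hj => ?_
    rw [r_sub]
    have hj : j ≠ k := by simp at hj; exact hj.1
    have h1 : (j : ℝ) - k ≠ 0 := sub_ne_zero.2 (by exact_mod_cast hj)
    have h2 : (j : ℝ) + k + a + b ≠ 0 := by positivity
    have h3 : a + b + k + (j : ℝ) ≠ 0 := by positivity
    unfold r
    field_simp
    ring
  have hk : k ∈ range (k + m + 1) := by simp
  have pe : ∀ c : ℝ, 0 < c → ∏ j ∈ (range (k + m + 1)).erase k, (c + (j : ℝ)) =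
      (∏ j ∈ range (k + m + 1), (c + (j : ℝ))) / (c + k) := by
    intro c hc
    rw [← mul_prod_erase _ _ hk]
    have : c + (k : ℝ) ≠ 0 := by positivity
    field_simp
  have hp : ∀ c : ℝ, 0 < c → 0 < ∏ j ∈ range (k + m + 1), (c + (j : ℝ)) := by
    intro c hc
    exact prod_pos fun j _ => by positivity
  have hs : 0 < a + b + k := by positivity
  rw [e1, pe a ha, pe b hb, pe _ hs, prod_erase_sub]
  unfold Real.GammaSeq
  have hA := hp a ha
  have hB := hp b hb
  have hC := hp _ hs
  have hn : (0 : ℝ) < ((k + m : ℕ) : ℝ) := by positivity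
  have hdf : (m.factorial : ℝ) * ((k + m).descFactorial k : ℝ) = (k + m).factorial := by
    have := Nat.factorial_mul_descFactorial (n := k + m) (k := k) (by omega)
    rw [Nat.add_sub_cancel_left] at this
    exact_mod_cast this
  have hdf' : ((k + m).descFactorial k : ℝ) = (k + m).factorial / m.factorial := by
    rw [← hdf]; field_simp
  rw [hdf', rpow_add hn, rpow_add hn, rpow_natCast]
  generalize (∏ j ∈ range (k + m + 1), (a + (j : ℝ))) = A at *
  generalize (∏ j ∈ range (k + m + 1), (b + (j : ℝ))) = B at *
  generalize (∏ j ∈ range (k + m + 1), (a + b + k + (j : ℝ))) = C at *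
  have hna := rpow_pos_of_pos hn a
  have hnb := rpow_pos_of_pos hn b
  generalize ((k + m : ℕ) : ℝ) ^ a = x at *
  generalize ((k + m : ℕ) : ℝ) ^ b = y at *
  have hz : (0 : ℝ) < ((k + m : ℕ) : ℝ) ^ k := by positivity
  generalize ((k + m : ℕ) : ℝ) ^ k = z at *
  have hF : (0 : ℝ) < ((k + m).factorial : ℝ) := by positivity
  generalize ((k + m).factorial : ℝ) = F at *
  have : (-1 : ℝ) ^ k * (-1) ^ k = 1 := by rw [← mul_pow]; simp
  have hi : ∀ X Y : ℝ, X / ((-1) ^ k * Y) = (-1) ^ k * (X / Y) := by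
    intro X Y
    have : ((-1 : ℝ) ^ k)⁻¹ = (-1) ^ k := inv_eq_of_mul_eq_one_left this
    rw [div_eq_mul_inv, mul_inv, this]; ring
  rw [mul_assoc ((-1 : ℝ) ^ k), mul_assoc ((-1 : ℝ) ^ k), hi, mul_div_assoc ((-1 : ℝ) ^ k), mul_assoc ((-1 : ℝ) ^ k), mul_assoc ((-1 : ℝ) ^ k)]
  congr 1
  have : a + k ≠ 0 := by positivity
  have : b + k ≠ 0 := by positivity
  have : (k : ℝ) + a ≠ 0 := by positivity
  have : (k : ℝ) + b ≠ 0 := by positivity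
  have : a + b + k + k ≠ 0 := by positivity
  field_simp
  ring

lemma w_tendsto {a b : ℝ} (ha : 0 < a) (hb : 0 < b) (k : ℕ) :
    Tendsto (fun N => w a b N k) atTop (𝓝 (W a b k)) := by
  rw [← tendsto_add_atTop_iff_nat k]
  have ht : Tendsto (fun m => k + m) atTop atTop := tendsto_atTop_mono (fun m => Nat.le_add_left m k) tendsto_id
  have hd : Tendsto (fun n : ℕ => ((n.descFactorial k : ℝ) / (n : ℝ) ^ k)) atTop (𝓝 1) := by
    have h1 : ∀ i ∈ range k, Tendsto (fun n : ℕ => ((n : ℝ) - i) / n) atTop (𝓝 1) := by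
      intro i _
      have : Tendsto (fun n : ℕ => 1 - (i : ℝ) / n) atTop (𝓝 (1 - 0)) :=
        tendsto_const_nhds.sub (tendsto_const_div_atTop_nhds_zero_nat _)
      rw [sub_zero] at this
      refine this.congr' ?_
      filter_upwards [eventually_gt_atTop 0] with n hn
      field_simp
    have h2 := tendsto_finsetProd _ h1
    simp only [prod_const_one] at h2
    refine h2.congr' ?_
    filter_upwards [eventually_ge_atTop k] with n hn
    rw [prod_div_distrib, Nat.descFactorial_eq_prod_range, Nat.cast_prod]
    simp only [prod_const, card_range]
    congr 1
    refine prod_congr rfl fun i hi => ?_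
    rw [Nat.cast_sub (by simp at hi; omega)]
  have hG := ((Real.GammaSeq_tendsto_Gamma (a + b + k)).div
    ((Real.GammaSeq_tendsto_Gamma a).mul (Real.GammaSeq_tendsto_Gamma b))
    (mul_pos (Gamma_pos_of_pos ha) (Gamma_pos_of_pos hb)).ne')
  have := (((hG.comp ht).const_mul
    ((-1) ^ k * (2 * k + a + b) / (k.factorial * ((k + a) * (k + b))))).mul (hd.comp ht))
  refine (this.congr' ?_).trans_eq ?_
  · filter_upwards [eventually_gt_atTop 0] with m hm
    rw [add_comm m k, w_closed ha hb k m hm]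
    rfl
  · congr 1
    have := (Gamma_pos_of_pos ha).ne'
    have := (Gamma_pos_of_pos hb).ne'
    have : (k : ℝ) + a ≠ 0 := by positivity
    have : (k : ℝ) + b ≠ 0 := by positivity
    unfold W
    field_simp

/-- truncated weight -/
noncomputable def wt (a b : ℝ) (N k : ℕ) : ℝ := if k ≤ N then w a b N k else 0

lemma wt_tendsto {a b : ℝ} (ha : 0 < a) (hb : 0 < b) (k : ℕ) :
    Tendsto (fun N => wt a b N k) atTop (𝓝 (W a b k)) := by
  refine (w_tendsto ha hb k).congr' ?_
  filter_upwards [eventually_ge_atTop k] with N hN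
  simp [wt, hN]

lemma wt_le {a b : ℝ} (ha : 0 < a) (hb : 0 < b) (N k : ℕ) : |wt a b N k| ≤ |W a b k| := by
  have hm : Monotone (fun N => |wt a b N k|) := by
    refine monotone_nat_of_le_succ fun N => ?_
    by_cases h : k ≤ N
    · simp only [wt, h, show k ≤ N + 1 by omega, if_true, w_succ h, abs_mul]
      refine le_mul_of_one_le_right (abs_nonneg _) ?_
      have h1 := r_strictMono ha hb (show k < N + 1 by omega)
      have h2 := r_pos ha hb k
      refine le_trans ?_ (le_abs_self _)
      rw [one_le_div (by linarith)]
      linarith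
    · simp [wt, h]
  exact hm.ge_of_tendsto (wt_tendsto ha hb k).abs N

lemma tannery {a b : ℝ} (ha : 0 < a) (hb : 0 < b) (h : ℕ → ℝ)
    (hs : Summable fun k => |W a b k| * |h k|) :
    Tendsto (fun N => ∑ k ∈ range (N + 1), w a b N k * h k) atTop (𝓝 (∑' k, W a b k * h k)) := by
  have h1 : ∀ N, ∑ k ∈ range (N + 1), w a b N k * h k = ∑' k, wt a b N k * h k := by
    intro N
    rw [tsum_eq_sum (s := range (N + 1))]
    · refine sum_congr rfl fun k hk => ?_
      have : k ≤ N := by simp at hk; omega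
      simp [wt, this]
    · intro k hk
      have : ¬ k ≤ N := by simp at hk; omega
      simp [wt, this]
  simp only [h1]
  refine tendsto_tsum_of_dominated_convergence hs (fun k => (wt_tendsto ha hb k).mul_const _)
    (Eventually.of_forall fun N k => ?_)
  rw [norm_mul, Real.norm_eq_abs, Real.norm_eq_abs]
  exact mul_le_mul_of_nonneg_right (wt_le ha hb N k) (abs_nonneg _)

lemma gamma_bound {s : ℝ} (hs : 0 < s) (k : ℕ) :
    Real.Gamma (s + k) ≤ Real.Gamma s * (s + 1) ^ k * k.factorial := by
  induction k with
  | zero => simp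
  | succ k ih =>
    have : s + (k + 1 : ℕ) = (s + k) + 1 := by push_cast; ring
    rw [this, Real.Gamma_add_one (by positivity), Nat.factorial_succ, pow_succ]
    have hG := Gamma_pos_of_pos hs
    calc (s + k) * Real.Gamma (s + k)
        ≤ ((s + 1) * (k + 1)) * (Real.Gamma s * (s + 1) ^ k * k.factorial) := by
          refine mul_le_mul ?_ ih (Gamma_pos_of_pos (by positivity)).le (by positivity)
          have : 0 ≤ s * k := by positivity
          nlinarith
      _ = _ := by push_cast; ring

lemma geom_summable (M c : ℝ) (hM : 0 < M) (hc : 0 < c) :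
    Summable fun k : ℕ => M ^ k * exp (-c * (k : ℝ) ^ 2) := by
  refine summable_of_ratio_test_tendsto_lt_one (l := 0) one_pos
    (Eventually.of_forall fun k => by positivity) ?_
  have h1 : Tendsto (fun k : ℕ => (M * exp (-c)) * exp (-(2 * c) * (k : ℝ))) atTop (𝓝 ((M * exp (-c)) * 0)) := by
    refine Tendsto.const_mul _ (tendsto_exp_atBot.comp ?_)
    exact tendsto_natCast_atTop_atTop.const_mul_atTop_of_neg (by linarith)
  rw [mul_zero] at h1
  refine h1.congr fun k => ?_
  rw [norm_of_nonneg (by positivity), norm_of_nonneg (by positivity)]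
  rw [eq_div_iff (by positivity), pow_succ]
  have : exp (-c * ((k + 1 : ℕ) : ℝ) ^ 2) = exp (-c) * exp (-(2 * c) * k) * exp (-c * (k : ℝ) ^ 2) := by
    rw [← exp_add, ← exp_add]; congr 1; push_cast; ring
  rw [this]; ring

lemma Wr_eq {a b : ℝ} (ha : 0 < a) (hb : 0 < b) (k : ℕ) :
    |W a b k| * r a b k = Real.Gamma (a + b + k) * (2 * k + a + b) /
      (2 * (k.factorial * Real.Gamma a * Real.Gamma b)) := by
  have := (Gamma_pos_of_pos ha)
  have := (Gamma_pos_of_pos hb)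
  have := (Gamma_pos_of_pos (show 0 < a + b + k by positivity))
  unfold W r
  rw [abs_div, abs_mul, abs_mul, abs_pow, abs_neg, abs_one, one_pow, one_mul]
  rw [abs_of_pos (by positivity), abs_of_pos (by positivity), abs_of_pos (by positivity)]
  field_simp

lemma summable_Wr {a b : ℝ} (ha : 0 < a) (hb : 0 < b) {l : ℝ} (hl : 0 < l) :
    Summable fun k => |W a b k| * |r a b k * exp (-r a b k * l)| := by
  have hg := geom_summable ((a + b + 1) * 2) (l / 2) (by positivity) (by positivity)
  have h1 := (Gamma_pos_of_pos ha)
  have h2 := (Gamma_pos_of_pos hb)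
  have h3 := (Gamma_pos_of_pos (add_pos ha hb))
  refine Summable.of_nonneg_of_le (fun k => by positivity) (fun k => ?_)
    (hg.mul_left (Real.Gamma (a + b) * (2 + a + b) / (2 * (Real.Gamma a * Real.Gamma b))))
  have hr := r_pos ha hb k
  rw [abs_of_pos (a := r a b k * _) (by positivity), ← mul_assoc, Wr_eq ha hb]
  have he : exp (-r a b k * l) ≤ exp (-(l / 2) * (k : ℝ) ^ 2) := by
    refine exp_le_exp.2 ?_
    have : (k : ℝ) ^ 2 / 2 ≤ r a b k := by
      unfold r
      have : (0 : ℝ) ≤ k * a := by positivity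
      have : (0 : ℝ) ≤ k * b := by positivity
      nlinarith [mul_pos ha hb]
    nlinarith
  have hk : (2 * k + a + b : ℝ) ≤ (2 + a + b) * 2 ^ k := by
    have h4 : (k : ℝ) < 2 ^ k := by exact_mod_cast k.lt_two_pow_self
    have h5 : (1 : ℝ) ≤ 2 ^ k := one_le_pow₀ (by norm_num)
    nlinarith
  calc _ ≤ (Real.Gamma (a + b) * (a + b + 1) ^ k * k.factorial) * ((2 + a + b) * 2 ^ k) /
      (2 * (k.factorial * Real.Gamma a * Real.Gamma b)) * exp (-(l / 2) * (k : ℝ) ^ 2) := by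
        gcongr
        exact gamma_bound (by positivity) k
    _ = _ := by rw [mul_pow]; field_simp

lemma summable_W {a b : ℝ} (ha : 0 < a) (hb : 0 < b) {l : ℝ} (hl : 0 < l) :
    Summable fun k => |W a b k| * |exp (-r a b k * l)| := by
  have h0 := r_pos ha hb 0
  refine Summable.of_nonneg_of_le (fun k => by positivity) (fun k => ?_)
    ((summable_Wr ha hb hl).mul_left (r a b 0)⁻¹)
  rw [abs_mul, abs_of_pos (r_pos ha hb k), mul_left_comm]
  refine mul_le_mul_of_nonneg_left ?_ (abs_nonneg _)
  rw [← mul_assoc]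
  refine le_mul_of_one_le_left (abs_nonneg _) ?_
  rw [inv_mul_eq_div, one_le_div h0]
  exact (r_strictMono ha hb).monotone (Nat.zero_le k)

noncomputable def Sinf (a b l : ℝ) : ℝ := ∑' k, W a b k * exp (-r a b k * l)

lemma density_eq {a b : ℝ} (ha : 0 < a) (hb : 0 < b) (l : ℝ) :
    polyaDensity a b l = ∑' k, W a b k * (r a b k * exp (-r a b k * l)) := by
  unfold polyaDensity
  congr 1
  funext k
  have he : -((k : ℝ) + a) * ((k : ℝ) + b) * l / 2 = -r a b k * l := by unfold r; ring
  rw [he, ← mul_assoc (W a b k)]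
  congr 1
  have h1 := (Gamma_pos_of_pos ha)
  have h2 := (Gamma_pos_of_pos hb)
  have h3 := (Gamma_pos_of_pos (add_pos ha hb))
  have : (k : ℝ) + a ≠ 0 := by positivity
  have : (k : ℝ) + b ≠ 0 := by positivity
  unfold W r betaFn
  field_simp
  ring

lemma Sinf_deriv {a b : ℝ} (ha : 0 < a) (hb : 0 < b) {l : ℝ} (hl : 0 < l) :
    HasDerivAt (fun l => -Sinf a b l) (polyaDensity a b l) l := by
  have h := hasDerivAt_tsum_of_isPreconnected (𝕜 := ℝ) (F := ℝ)
    (g := fun k l => W a b k * exp (-r a b k * l))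
    (g' := fun k l => W a b k * (exp (-r a b k * l) * (-r a b k)))
    (u := fun k => |W a b k| * |r a b k * exp (-r a b k * (l / 2))|)
    (t := Set.Ioi (l / 2)) (y₀ := l) (y := l) (summable_Wr ha hb (half_pos hl)) isOpen_Ioi
    isPreconnected_Ioi ?_ ?_ (by simp; linarith) ?_ (by simp; linarith)
  · rw [density_eq ha hb]
    refine h.neg.congr_deriv ?_
    rw [← tsum_neg]
    congr 1; funext k; ring
  · intro k y _
    refine HasDerivAt.const_mul _ (HasDerivAt.exp ?_)
    exact ((hasDerivAt_id' y).const_mul (-r a b k)).congr_deriv (mul_one _)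
  · intro k y hy
    have hr := r_pos ha hb k
    rw [norm_mul, Real.norm_eq_abs, Real.norm_eq_abs, abs_mul, abs_mul, abs_neg,
      abs_of_pos hr, abs_of_pos (exp_pos _), abs_of_pos (exp_pos _), mul_comm (exp _)]
    have : exp (-r a b k * y) ≤ exp (-r a b k * (l / 2)) := by
      refine exp_le_exp.2 ?_
      have : l / 2 < y := hy
      nlinarith
    gcongr
  · refine Summable.of_norm ?_
    simpa [abs_mul] using summable_W ha hb hl

lemma Sinf_atTop {a b : ℝ} (ha : 0 < a) (hb : 0 < b) :
    Tendsto (Sinf a b) atTop (𝓝 0) := by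
  have h := tendsto_tsum_of_dominated_convergence (𝓕 := atTop) (β := ℕ)
    (f := fun (l : ℝ) k => W a b k * exp (-r a b k * l)) (g := fun _ => (0 : ℝ))
    (summable_W ha hb one_pos) ?_ ?_
  · rw [tsum_zero] at h; exact h
  · intro k
    rw [← mul_zero (W a b k)]
    refine Tendsto.const_mul _ (tendsto_exp_atBot.comp ?_)
    exact tendsto_id.const_mul_atTop_of_neg (neg_neg_of_pos (r_pos ha hb k))
  · filter_upwards [eventually_ge_atTop 1] with l hl k
    have hr := r_pos ha hb k
    rw [norm_mul, Real.norm_eq_abs, Real.norm_eq_abs, abs_of_pos (exp_pos _), abs_of_pos (exp_pos _)]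
    have : exp (-r a b k * l) ≤ exp (-r a b k * 1) := by
      refine exp_le_exp.2 ?_
      nlinarith
    gcongr

lemma S_tendsto {a b : ℝ} (ha : 0 < a) (hb : 0 < b) {l : ℝ} (hl : 0 < l) :
    Tendsto (fun N => S a b N l) atTop (𝓝 (Sinf a b l)) :=
  tannery ha hb _ (summable_W ha hb hl)

lemma density_nonneg {a b : ℝ} (ha : 0 < a) (hb : 0 < b) {l : ℝ} (hl : 0 < l) :
    0 ≤ polyaDensity a b l := by
  rw [density_eq ha hb]
  exact ge_of_tendsto' (tannery ha hb _ (summable_Wr ha hb hl)) fun N => f_nonneg ha hb N l hl.le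

lemma S_deriv (a b : ℝ) (N : ℕ) (l : ℝ) : HasDerivAt (S a b N) (-f a b N l) l := by
  have h : HasDerivAt (S a b N) (∑ k ∈ range (N + 1),
      w a b N k * (exp (-r a b k * l) * (-r a b k))) l := by
    unfold S
    refine HasDerivAt.fun_sum fun k _ => ?_
    refine HasDerivAt.const_mul _ (HasDerivAt.exp ?_)
    exact ((hasDerivAt_id' l).const_mul (-r a b k)).congr_deriv (mul_one _)
  refine h.congr_deriv ?_
  unfold f
  rw [← sum_neg_distrib]
  exact sum_congr rfl fun k _ => by ring

lemma S_le_one {a b : ℝ} (ha : 0 < a) (hb : 0 < b) (N : ℕ) {l : ℝ} (hl : 0 ≤ l) :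
    S a b N l ≤ 1 := by
  have : AntitoneOn (S a b N) (Set.Ici 0) := by
    refine antitoneOn_of_deriv_nonpos (convex_Ici 0)
      (fun x _ => (S_deriv a b N x).continuousAt.continuousWithinAt)
      (fun x _ => (S_deriv a b N x).differentiableAt.differentiableWithinAt) fun x hx => ?_
    rw [(S_deriv a b N x).deriv]
    have := f_nonneg ha hb N x (by simp at hx; exact hx.le)
    linarith
  have h := this (by simp) (by simpa using hl) hl
  rwa [S_zero ha hb] at h

lemma Sinf_zero {a b : ℝ} (ha : 0 < a) (hb : 0 < b) :
    Tendsto (Sinf a b) (𝓝[>] 0) (𝓝 1) := by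
  have h0 : Tendsto (S a b 0) (𝓝[>] 0) (𝓝 1) := by
    have := (S_deriv a b 0 0).continuousAt.tendsto
    rw [S_zero ha hb] at this
    exact this.mono_left nhdsWithin_le_nhds
  refine tendsto_of_tendsto_of_tendsto_of_le_of_le' h0 tendsto_const_nhds ?_ ?_
  · filter_upwards [self_mem_nhdsWithin] with l hl
    exact (S_mono ha hb (le_of_lt hl)).ge_of_tendsto (S_tendsto ha hb hl) 0
  · filter_upwards [self_mem_nhdsWithin] with l hl
    exact le_of_tendsto' (S_tendsto ha hb hl) fun N => S_le_one ha hb N (le_of_lt hl)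

end PolyaAux

/-- The Pólya density integrates to one over `(0,∞)`. -/
theorem polyaDensity_integral_eq_one (a b : ℝ) (ha : 0 < a) (hb : 0 < b) :
    ∫ l in Set.Ioi (0 : ℝ), polyaDensity a b l = 1 := by
  have hd : ∀ x ∈ Set.Ioi (0 : ℝ), HasDerivAt
      (Function.update (fun l => -PolyaAux.Sinf a b l) 0 (-1)) (polyaDensity a b x) x := by
    intro x hx
    refine (PolyaAux.Sinf_deriv ha hb hx).congr_of_eventuallyEq ?_
    filter_upwards [isOpen_Ioi.mem_nhds hx] with y hy
    exact Function.update_of_ne (ne_of_gt hy) _ _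
  have h := integral_Ioi_of_hasDerivAt_of_nonneg
    (g := Function.update (fun l => -PolyaAux.Sinf a b l) 0 (-1)) (l := 0) ?_ hd
    (fun x hx => PolyaAux.density_nonneg ha hb hx) ?_
  · rw [h]; simp
  · rw [continuousWithinAt_update_same, Set.Ici_sdiff_left]
    exact (PolyaAux.Sinf_zero ha hb).neg
  · have := (PolyaAux.Sinf_atTop ha hb).neg
    rw [neg_zero] at this
    refine this.congr' ?_
    filter_upwards [eventually_gt_atTop 0] with y hy
    exact (Function.update_of_ne (ne_of_gt hy) (-1) (fun l => -PolyaAux.Sinf a b l)).symm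
end
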